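/- Space-time duality for densities: Let 1 < α ≤ 2, γ = 1/α, b > 0. Let g_γ(x) = p_γ(x; γ, b) be the density of the stable subordinator at time 1, and let h(x,t) = (t/γ) x^{−1−1/γ} g_γ(t x^{−1/γ}) for x > 0, t > 0 be the density of the inverse stable subordinator. Then for all x > 0 and t > 0, p_α(x; 2−α, b^{−α} t) = γ · h(x,t); equivalently, p_α(x; 2−α, b^{−α} t) = t x^{−1−α} g_γ(t x^{−α}). -/

import Mathlib

open MeasureTheory Real Set

/-- Zolotarev's parametrization of the stable density: the real-valued inverse Fourier
integral `p_α(x; η, b) = (1/(2π)) ∫ e^{-iλx} exp(-b|λ|^α e^{-iπη·sgn(λ)/2}) dλ`. -/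
noncomputable def zolDensity (α η b x : ℝ) : ℝ :=
  (1 / (2 * Real.pi)) *
    (∫ l : ℝ, Complex.exp (-Complex.I * (l : ℂ) * (x : ℂ)) *
        Complex.exp (-(b : ℂ) * ((|l| ^ α : ℝ) : ℂ) *
          Complex.exp (-Complex.I * (Real.pi : ℂ) * (η : ℂ) * ((Real.sign l : ℝ) : ℂ) / 2))).re

/-- The entire function obtained from the two integrands in logarithmic coordinates. -/
noncomputable def dualPhi (α x B : ℝ) (w : ℂ) : ℂ :=
  Complex.exp (-(x : ℂ) * Complex.exp w + (B : ℂ) * Complex.exp ((α : ℂ) * w))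

lemma dual_expo {k c : ℝ} (hk : 0 < k) (hc : 0 < c) :
    (fun u : ℝ => c * Real.exp (k * u)) '' univ = Ioi 0 := by
  ext y
  simp only [image_univ, mem_range, mem_Ioi]
  constructor
  · rintro ⟨u, rfl⟩
    positivity
  · intro hy
    refine ⟨Real.log (y / c) / k, ?_⟩
    rw [mul_div_cancel₀ _ hk.ne', Real.exp_log (by positivity)]
    field_simp

lemma dual_deriv (k c : ℝ) (u : ℝ) :
    HasDerivWithinAt (fun u : ℝ => c * Real.exp (k * u)) (c * (Real.exp (k * u) * k)) univ u := by
  have h1 : HasDerivAt (fun u : ℝ => k * u) k u := by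
    simpa using (hasDerivAt_id u).const_mul k
  exact ((h1.exp).const_mul c).hasDerivWithinAt

lemma dual_inj {k c : ℝ} (hk : 0 < k) (hc : 0 < c) :
    InjOn (fun u : ℝ => c * Real.exp (k * u)) univ := by
  intro a _ b _ h
  have h2 : Real.exp (k * a) = Real.exp (k * b) := mul_left_cancel₀ hc.ne' h
  exact mul_left_cancel₀ hk.ne' (Real.exp_injective h2)

lemma dual_cov {k c : ℝ} (hk : 0 < k) (hc : 0 < c) (f : ℝ → ℂ) :
    ∫ l in Ioi (0 : ℝ), f l =
      ∫ u : ℝ, (c * (Real.exp (k * u) * k)) • f (c * Real.exp (k * u)) := by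
  rw [← dual_expo hk hc, integral_image_eq_integral_abs_deriv_smul MeasurableSet.univ
    (fun u _ => dual_deriv k c u) (dual_inj hk hc), setIntegral_univ]
  congr 1
  ext u
  rw [abs_of_pos (by positivity)]

lemma dual_cov_int {E : Type*} [NormedAddCommGroup E] [NormedSpace ℝ E]
    {k c : ℝ} (hk : 0 < k) (hc : 0 < c) (f : ℝ → E) :
    IntegrableOn f (Ioi 0) ↔
      Integrable (fun u : ℝ => (c * (Real.exp (k * u) * k)) • f (c * Real.exp (k * u))) := by
  rw [← dual_expo hk hc, integrableOn_image_iff_integrableOn_abs_deriv_smul MeasurableSet.univ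
    (fun u _ => dual_deriv k c u) (dual_inj hk hc), integrableOn_univ]
  have : ∀ u : ℝ, |c * (Real.exp (k * u) * k)| = c * (Real.exp (k * u) * k) :=
    fun u => abs_of_pos (by positivity)
  simp only [this]

lemma dual_dom_int {k c : ℝ} (hk : 0 < k) (hc : 0 < c) :
    Integrable (fun u : ℝ => Real.exp (k * u) * Real.exp (c - c * Real.exp u)) := by
  have h := integrableOn_rpow_mul_exp_neg_mul_rpow (p := 1) (s := k - 1) (b := c)
    (by linarith) one_pos hc
  rw [dual_cov_int one_pos one_pos] at h
  refine (h.const_mul (Real.exp c)).congr (ae_of_all _ fun u => ?_)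
  simp only [one_mul, mul_one, smul_eq_mul, Real.rpow_one]
  rw [← Real.exp_mul, ← Real.exp_add, ← Real.exp_add, ← Real.exp_add, ← Real.exp_add]
  congr 1
  ring

lemma dualPhi_norm (α x B u θ : ℝ) : ‖dualPhi α x B (u + θ * Complex.I)‖ =
    Real.exp (-x * (Real.exp u * Real.cos θ) + B * (Real.exp (α * u) * Real.cos (α * θ))) := by
  rw [dualPhi, Complex.norm_exp]
  congr 1
  simp [Complex.exp_re]

lemma dualPhi_bound {α x B : ℝ} (hα1 : 1 < α) (hα2 : α ≤ 2) (hx : 0 < x) (hB : 0 < B) :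
    ∃ c : ℝ, 0 < c ∧ ∀ θ ∈ Icc (π / (2 * α)) (π / 2), ∀ u : ℝ,
      ‖dualPhi α x B (u + θ * Complex.I)‖ ≤ Real.exp (c - c * Real.exp u) := by
  have hα0 : 0 < α := by linarith
  have hpi := Real.pi_pos
  have hθ0 : 0 < π / (2 * α) := by positivity
  have hle : π / (2 * α) ≤ π / 2 := by
    apply div_le_div_of_nonneg_left hpi.le (by norm_num) (by linarith)
  have key : ∀ θ ∈ Icc (π / (2 * α)) (π / 2), π / 2 ≤ α * θ ∧ α * θ ≤ π := by
    intro θ hθ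
    constructor
    · have := mul_le_mul_of_nonneg_left hθ.1 hα0.le
      have e : α * (π / (2 * α)) = π / 2 := by field_simp
      linarith
    · nlinarith [hθ.2, hθ.1]
  have hcos : ∀ θ ∈ Icc (π / (2 * α)) (π / 2), 0 ≤ Real.cos θ ∧ Real.cos (α * θ) ≤ 0 := by
    intro θ hθ
    refine ⟨Real.cos_nonneg_of_neg_pi_div_two_le_of_le (by linarith [hθ.1]) hθ.2,
      Real.cos_nonpos_of_pi_div_two_le_of_le (key θ hθ).1 (by linarith [(key θ hθ).2])⟩
  obtain ⟨θ₀, hθ₀, hmin⟩ := (isCompact_Icc (a := π / (2 * α)) (b := π / 2)).exists_isMinOn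
    (nonempty_Icc.2 hle) (f := fun θ => x * Real.cos θ - B * Real.cos (α * θ))
    (by fun_prop)
  refine ⟨x * Real.cos θ₀ - B * Real.cos (α * θ₀), ?_, ?_⟩
  · obtain ⟨h1, h2⟩ := hcos θ₀ hθ₀
    rcases hθ₀.2.lt_or_eq with h | h
    · have : 0 < Real.cos θ₀ := Real.cos_pos_of_mem_Ioo ⟨by linarith [hθ₀.1], h⟩
      nlinarith [mul_pos hx this]
    · have : Real.cos (α * θ₀) < 0 := by
        apply Real.cos_neg_of_pi_div_two_lt_of_lt
        · rw [h]; nlinarith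
        · linarith [(key θ₀ hθ₀).2]
      nlinarith [mul_pos hB (neg_pos.2 this), mul_nonneg hx.le h1]
  · intro θ hθ u
    have hm : x * Real.cos θ₀ - B * Real.cos (α * θ₀) ≤ x * Real.cos θ - B * Real.cos (α * θ) :=
      hmin hθ
    obtain ⟨h1, h2⟩ := hcos θ hθ
    obtain ⟨h3, h4⟩ := hcos θ₀ hθ₀
    have hc0 : 0 ≤ x * Real.cos θ₀ - B * Real.cos (α * θ₀) := by
      nlinarith [mul_nonneg hx.le h3, mul_nonneg hB.le (neg_nonneg.2 h4)]
    generalize x * Real.cos θ₀ - B * Real.cos (α * θ₀) = c at *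
    rw [dualPhi_norm]
    apply Real.exp_le_exp.2
    have e1 := Real.exp_pos u
    have e2 := Real.exp_pos (α * u)
    have p1 : 0 ≤ x * Real.cos θ := mul_nonneg hx.le h1
    have p2 : 0 ≤ -(B * Real.cos (α * θ)) := by nlinarith [mul_nonneg hB.le (neg_nonneg.2 h2)]
    rcases le_total 0 u with hu | hu
    · have e3 : Real.exp u ≤ Real.exp (α * u) := Real.exp_le_exp.2 (by nlinarith)
      nlinarith [mul_nonneg p2 (sub_nonneg.2 e3), mul_nonneg e1.le (sub_nonneg.2 hm)]
    · have e3 : Real.exp u ≤ 1 := Real.exp_le_one_iff.2 hu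
      nlinarith [mul_nonneg p1 e1.le, mul_nonneg p2 e2.le, mul_nonneg hc0 (sub_nonneg.2 e3)]

lemma dualPhi_diff (α x B : ℝ) : Differentiable ℂ (dualPhi α x B) := by
  unfold dualPhi
  fun_prop

lemma dual_int {α x B k : ℝ} (hα1 : 1 < α) (hα2 : α ≤ 2) (hx : 0 < x) (hB : 0 < B) (hk : 0 < k)
    {θ : ℝ} (hθ : θ ∈ Icc (π / (2 * α)) (π / 2)) :
    Integrable (fun u : ℝ => dualPhi α x B (u + θ * Complex.I) *
      Complex.exp (k * (u + θ * Complex.I))) := by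
  obtain ⟨c, hc, hb⟩ := dualPhi_bound hα1 hα2 hx hB
  refine (dual_dom_int hk hc).mono' ?_ (ae_of_all _ fun u => ?_)
  · apply Continuous.aestronglyMeasurable
    have := (dualPhi_diff α x B).continuous
    fun_prop
  · rw [norm_mul, mul_comm, Complex.norm_exp]
    have : ((k : ℂ) * (u + θ * Complex.I)).re = k * u := by simp
    rw [this]
    exact mul_le_mul_of_nonneg_left (hb θ hθ u) (Real.exp_pos _).le

lemma dual_shift {α x B : ℝ} (hα1 : 1 < α) (hα2 : α ≤ 2) (hx : 0 < x) (hB : 0 < B) :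
    ∫ u : ℝ, dualPhi α x B (u + ((π / (2 * α) : ℝ) : ℂ) * Complex.I) *
      Complex.exp (u + ((π / (2 * α) : ℝ) : ℂ) * Complex.I) =
    ∫ u : ℝ, dualPhi α x B (u + ((π / 2 : ℝ) : ℂ) * Complex.I) *
      Complex.exp (u + ((π / 2 : ℝ) : ℂ) * Complex.I) := by
  have hle : π / (2 * α) ≤ π / 2 := by
    apply div_le_div_of_nonneg_left Real.pi_pos.le (by norm_num) (by linarith)
  set a := π / (2 * α) with ha
  set d := π / 2 with hd
  obtain ⟨c, hc, hb⟩ := dualPhi_bound hα1 hα2 hx hB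
  set f : ℂ → ℂ := fun w => dualPhi α x B w * Complex.exp w with hf
  have hfd : Differentiable ℂ f := (dualPhi_diff α x B).mul Complex.differentiable_exp
  have hI : ∀ θ ∈ Icc a d, Integrable (fun u : ℝ => f (u + θ * Complex.I)) := by
    intro θ hθ
    simpa using dual_int hα1 hα2 hx hB one_pos hθ
  have hbd : ∀ u : ℝ, ‖∫ y in a..d, f (u + y * Complex.I)‖ ≤
      Real.exp (c - c * Real.exp u) * Real.exp u * |d - a| := by
    intro u
    apply intervalIntegral.norm_integral_le_of_norm_le_const
    intro y hy
    rw [uIoc_of_le hle] at hy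
    rw [hf, norm_mul, Complex.norm_exp]
    have : ((u : ℂ) + y * Complex.I).re = u := by simp
    rw [this]
    exact mul_le_mul_of_nonneg_right (hb y ⟨hy.1.le, hy.2⟩ u) (Real.exp_pos _).le
  have htop : Filter.Tendsto (fun u : ℝ => ∫ y in a..d, f (u + y * Complex.I))
      Filter.atTop (nhds 0) := by
    refine squeeze_zero_norm hbd ?_
    have h0 : Filter.Tendsto (fun r : ℝ => Real.exp c * (r ^ (1 : ℝ) * Real.exp (-c * r)) * |d - a|)
        Filter.atTop (nhds (Real.exp c * 0 * |d - a|)) :=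
      ((tendsto_rpow_mul_exp_neg_mul_atTop_nhds_zero 1 c hc).const_mul _).mul_const _
    have h1 := h0.comp Real.tendsto_exp_atTop
    simp only [mul_zero, zero_mul] at h1
    refine h1.congr fun u => ?_
    simp only [Function.comp, Real.rpow_one, sub_eq_add_neg, Real.exp_add, neg_mul]
    ring
  have hbot : Filter.Tendsto (fun u : ℝ => ∫ y in a..d, f (u + y * Complex.I))
      Filter.atBot (nhds 0) := by
    refine squeeze_zero_norm hbd ?_
    have h0 : Continuous (fun r : ℝ => Real.exp (c - c * r) * r * |d - a|) := by fun_prop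
    have h1 := (h0.tendsto 0).comp Real.tendsto_exp_atBot
    simp only [mul_zero, zero_mul] at h1
    exact h1
  have hrect : ∀ T : ℝ, (∫ u in (-T)..T, f (u + a * Complex.I)) -
      (∫ u in (-T)..T, f (u + d * Complex.I)) +
      Complex.I • (∫ y in a..d, f ((T : ℝ) + y * Complex.I)) -
      Complex.I • (∫ y in a..d, f ((-T : ℝ) + y * Complex.I)) = 0 := by
    intro T
    have := Complex.integral_boundary_rect_eq_zero_of_differentiableOn f ⟨-T, a⟩ ⟨T, d⟩
      hfd.differentiableOn
    simpa using this
  have hl := (((intervalIntegral_tendsto_integral (hI a ⟨le_rfl, hle⟩)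
      Filter.tendsto_neg_atTop_atBot Filter.tendsto_id).sub
    (intervalIntegral_tendsto_integral (hI d ⟨hle, le_rfl⟩)
      Filter.tendsto_neg_atTop_atBot Filter.tendsto_id)).add
    (htop.const_smul Complex.I)).sub
    ((hbot.comp Filter.tendsto_neg_atTop_atBot).const_smul Complex.I)
  have h0 := tendsto_nhds_unique (hl.congr hrect) tendsto_const_nhds
  simp only [smul_zero, add_zero, sub_zero] at h0
  exact sub_eq_zero.1 h0

lemma dual_ibp {α x B : ℝ} (hα1 : 1 < α) (hα2 : α ≤ 2) (hx : 0 < x) (hB : 0 < B)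
    {θ : ℝ} (hθ : θ ∈ Icc (π / (2 * α)) (π / 2)) :
    (α * B : ℂ) * ∫ u : ℝ, dualPhi α x B (u + θ * Complex.I) *
      Complex.exp (α * (u + θ * Complex.I)) =
    x * (∫ u : ℝ, dualPhi α x B (u + θ * Complex.I) *
      Complex.exp (u + θ * Complex.I)) - 1 := by
  have hα0 : 0 < α := by linarith
  obtain ⟨c, hc, hb⟩ := dualPhi_bound hα1 hα2 hx hB
  have i1 := dual_int hα1 hα2 hx hB hα0 hθ
  have i2 := dual_int hα1 hα2 hx hB one_pos hθ
  simp only [Complex.ofReal_one, one_mul] at i2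
  have hder : ∀ u : ℝ, HasDerivAt (fun u : ℝ => dualPhi α x B (u + θ * Complex.I))
      ((α * B : ℂ) * (dualPhi α x B (u + θ * Complex.I) *
      Complex.exp (α * (u + θ * Complex.I))) - x * (dualPhi α x B (u + θ * Complex.I) *
      Complex.exp (u + θ * Complex.I))) u := by
    intro u
    have e0 : HasDerivAt (fun u : ℝ => (u : ℂ) + θ * Complex.I) 1 u :=
      (Complex.ofRealCLM.hasDerivAt (x := u)).add_const _
    have e1 := (e0.cexp).const_mul (-(x : ℂ))
    have e2 := ((e0.const_mul (α : ℂ)).cexp).const_mul (B : ℂ)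
    have e3 := (e1.add e2).cexp
    refine e3.congr_deriv ?_
    simp only [dualPhi, Pi.add_apply]
    ring
  have hbot : Filter.Tendsto (fun u : ℝ => dualPhi α x B (u + θ * Complex.I))
      Filter.atBot (nhds 1) := by
    have z : ∀ k : ℝ, 0 < k → Filter.Tendsto (fun u : ℝ => Complex.exp (k * (u + θ * Complex.I)))
        Filter.atBot (nhds 0) := by
      intro k hk
      rw [tendsto_zero_iff_norm_tendsto_zero]
      have : ∀ u : ℝ, ‖Complex.exp (k * (u + θ * Complex.I))‖ = Real.exp (k * u) := by
        intro u
        rw [Complex.norm_exp]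
        simp
      simp only [this]
      exact Real.tendsto_exp_atBot.comp (Filter.tendsto_id.const_mul_atBot hk)
    have z1 := z 1 one_pos
    simp only [Complex.ofReal_one, one_mul] at z1
    have := (Complex.continuous_exp.tendsto _).comp
      ((z1.const_mul (-(x : ℂ))).add ((z α hα0).const_mul (B : ℂ)))
    simp only [mul_zero, add_zero, Complex.exp_zero] at this
    exact this
  have htop : Filter.Tendsto (fun u : ℝ => dualPhi α x B (u + θ * Complex.I))
      Filter.atTop (nhds 0) := by
    refine squeeze_zero_norm (hb θ hθ) ?_
    refine Real.tendsto_exp_atBot.comp ?_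
    have : Filter.Tendsto (fun u : ℝ => c + -(c * Real.exp u)) Filter.atTop Filter.atBot :=
      Filter.tendsto_atBot_add_const_left _ _ (Filter.tendsto_neg_atTop_atBot.comp
        (Real.tendsto_exp_atTop.const_mul_atTop hc))
    simpa [sub_eq_add_neg] using this
  have h := integral_of_hasDerivAt_of_tendsto hder
    ((i1.const_mul _).sub (i2.const_mul _)) hbot htop
  rw [integral_sub (i1.const_mul _) (i2.const_mul _), integral_const_mul, integral_const_mul] at h
  linear_combination h

lemma int_neg_half {F : ℝ → ℂ} (h : IntegrableOn (fun l => F (-l)) (Ioi 0)) :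
    IntegrableOn F (Iic 0) := by
  rw [← (Measure.measurePreserving_neg (volume : Measure ℝ)).integrableOn_comp_preimage
      (Homeomorph.neg ℝ).measurableEmbedding]
  simp only [Function.comp_def, neg_preimage, neg_Iic, neg_zero]
  rw [integrableOn_Ici_iff_integrableOn_Ioi]
  exact h

lemma zol_half (α η b x : ℝ)
    (hi : IntegrableOn (fun l : ℝ => Complex.exp (-Complex.I * (l : ℂ) * (x : ℂ)) *
        Complex.exp (-(b : ℂ) * ((l ^ α : ℝ) : ℂ) *
          Complex.exp (-Complex.I * (Real.pi : ℂ) * (η : ℂ) / 2))) (Ioi 0)) :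
    zolDensity α η b x = 1 / π * (∫ l in Ioi (0 : ℝ),
      Complex.exp (-Complex.I * (l : ℂ) * (x : ℂ)) *
        Complex.exp (-(b : ℂ) * ((l ^ α : ℝ) : ℂ) *
          Complex.exp (-Complex.I * (Real.pi : ℂ) * (η : ℂ) / 2))).re := by
  set q : ℝ → ℂ := fun l : ℝ => Complex.exp (-Complex.I * (l : ℂ) * (x : ℂ)) *
        Complex.exp (-(b : ℂ) * ((l ^ α : ℝ) : ℂ) *
          Complex.exp (-Complex.I * (Real.pi : ℂ) * (η : ℂ) / 2)) with hq
  set F : ℝ → ℂ := fun l : ℝ => Complex.exp (-Complex.I * (l : ℂ) * (x : ℂ)) *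
        Complex.exp (-(b : ℂ) * ((|l| ^ α : ℝ) : ℂ) *
          Complex.exp (-Complex.I * (Real.pi : ℂ) * (η : ℂ) * ((Real.sign l : ℝ) : ℂ) / 2)) with hF
  have hpos : ∀ l ∈ Ioi (0 : ℝ), F l = q l := by
    intro l hl
    simp only [hF, hq, abs_of_pos (mem_Ioi.1 hl), Real.sign_of_pos hl]
    simp
  have hneg : ∀ l ∈ Ioi (0 : ℝ), F (-l) = (starRingEnd ℂ) (q l) := by
    intro l hl
    have h0 : -l < 0 := neg_lt_zero.2 hl
    simp only [hF, hq, abs_neg, abs_of_pos (mem_Ioi.1 hl), Real.sign_of_neg h0]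
    simp only [map_mul, ← Complex.exp_conj, map_neg, map_div₀, Complex.conj_I, Complex.conj_ofReal,
      map_ofNat]
    simp
  have iP : IntegrableOn F (Ioi 0) := hi.congr_fun (fun l hl => (hpos l hl).symm) measurableSet_Ioi
  have iN' : IntegrableOn (fun l => F (-l)) (Ioi 0) := by
    have : IntegrableOn (fun l => (starRingEnd ℂ) (q l)) (Ioi 0) :=
      Complex.conjCLE.toContinuousLinearMap.integrable_comp hi
    exact this.congr_fun (fun l hl => (hneg l hl).symm) measurableSet_Ioi
  have iN : IntegrableOn F (Iic 0) := by
    exact int_neg_half iN'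
  have e1 : ∫ l, F l = (∫ l in Ioi (0 : ℝ), F (-l)) + ∫ l in Ioi (0 : ℝ), F l := by
    rw [integral_comp_neg_Ioi, neg_zero, intervalIntegral.integral_Iic_add_Ioi iN iP]
  have e2 : ∫ l in Ioi (0 : ℝ), F l = ∫ l in Ioi (0 : ℝ), q l :=
    setIntegral_congr_fun measurableSet_Ioi hpos
  have e3 : ∫ l in Ioi (0 : ℝ), F (-l) = (starRingEnd ℂ) (∫ l in Ioi (0 : ℝ), q l) := by
    rw [setIntegral_congr_fun measurableSet_Ioi hneg, integral_conj]
  have e4 : zolDensity α η b x = (1 / (2 * π)) * (∫ l, F l).re := rfl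
  rw [e4, e1, e2, e3, Complex.add_re, Complex.conj_re]
  field_simp
  ring

lemma zol_left {α x B : ℝ} (hα1 : 1 < α) (hα2 : α ≤ 2) (hx : 0 < x) (hB : 0 < B) :
    zolDensity α (2 - α) B x = 1 / π * (-Complex.I *
      ∫ u : ℝ, dualPhi α x B (u + ((π / 2 : ℝ) : ℂ) * Complex.I) *
        Complex.exp (u + ((π / 2 : ℝ) : ℂ) * Complex.I)).re := by
  have hle : π / (2 * α) ≤ π / 2 := by
    apply div_le_div_of_nonneg_left Real.pi_pos.le (by norm_num) (by linarith)
  have hI := dual_int hα1 hα2 hx hB one_pos (θ := π / 2) ⟨hle, le_rfl⟩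
  simp only [Complex.ofReal_one, one_mul] at hI
  have key : ∀ u : ℝ, (1 * (Real.exp (1 * u) * 1)) •
      (Complex.exp (-Complex.I * ((1 * Real.exp (1 * u) : ℝ) : ℂ) * (x : ℂ)) *
        Complex.exp (-(B : ℂ) * (((1 * Real.exp (1 * u)) ^ α : ℝ) : ℂ) *
          Complex.exp (-Complex.I * (Real.pi : ℂ) * ((2 - α : ℝ) : ℂ) / 2))) =
      -Complex.I * (dualPhi α x B (u + ((π / 2 : ℝ) : ℂ) * Complex.I) *
        Complex.exp (u + ((π / 2 : ℝ) : ℂ) * Complex.I)) := by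
    intro u
    have e1 : Complex.exp (u + ((π / 2 : ℝ) : ℂ) * Complex.I) = Complex.exp u * Complex.I := by
      rw [Complex.exp_add]
      push_cast
      rw [Complex.exp_pi_div_two_mul_I]
    have e2 : Complex.exp (-Complex.I * (Real.pi : ℂ) * ((2 - α : ℝ) : ℂ) / 2) =
        -Complex.exp (α * (((π / 2 : ℝ) : ℂ) * Complex.I)) := by
      have : -Complex.I * (Real.pi : ℂ) * ((2 - α : ℝ) : ℂ) / 2 =
          α * (((π / 2 : ℝ) : ℂ) * Complex.I) - π * Complex.I := by
        push_cast
        ring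
      rw [this, Complex.exp_sub_pi_mul_I]
    have e3 : (((1 * Real.exp (1 * u)) ^ α : ℝ) : ℂ) = Complex.exp (α * u) := by
      rw [one_mul, one_mul, ← Real.exp_mul]
      push_cast
      rw [mul_comm]
    rw [e2, e3, dualPhi, e1, mul_add (α : ℂ), Complex.exp_add (α * (u : ℂ)), ← Complex.exp_add,
      Complex.real_smul]
    push_cast
    simp only [one_mul, mul_one]
    have e4 : -(x : ℂ) * (Complex.exp u * Complex.I) + B * (Complex.exp (α * u) *
        Complex.exp (α * ((π : ℂ) / 2 * Complex.I))) = -Complex.I * Complex.exp u * x +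
        -(B : ℂ) * Complex.exp (α * u) * -Complex.exp (α * ((π : ℂ) / 2 * Complex.I)) := by ring
    rw [e4]
    linear_combination (Complex.exp u * Complex.exp (-Complex.I * Complex.exp u * x +
        -(B : ℂ) * Complex.exp (α * u) * -Complex.exp (α * ((π : ℂ) / 2 * Complex.I)))) *
        Complex.I_mul_I
  rw [zol_half, dual_cov one_pos one_pos]
  · rw [← integral_const_mul]
    simp only [key]
  · rw [dual_cov_int one_pos one_pos]
    simp only [key]
    exact hI.const_mul _

lemma zol_right {α x b t : ℝ} (hα1 : 1 < α) (hα2 : α ≤ 2) (hx : 0 < x) (hb : 0 < b)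
    (ht : 0 < t) :
    zolDensity (1 / α) (1 / α) b (t * x ^ (-α)) = 1 / π * (-Complex.I * (α * (x / b) ^ α : ℝ) *
      ∫ u : ℝ, dualPhi α x (b ^ (-α) * t) (u + ((π / (2 * α) : ℝ) : ℂ) * Complex.I) *
        Complex.exp (α * (u + ((π / (2 * α) : ℝ) : ℂ) * Complex.I))).re := by
  have hα0 : 0 < α := by linarith
  have hle : π / (2 * α) ≤ π / 2 := by
    apply div_le_div_of_nonneg_left Real.pi_pos.le (by norm_num) (by linarith)
  set B := b ^ (-α) * t with hBdef
  have hB : 0 < B := by positivity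
  have hI := dual_int hα1 hα2 hx hB hα0 (θ := π / (2 * α)) ⟨le_rfl, hle⟩
  set c := (x / b) ^ α with hc
  have hc0 : 0 < c := by positivity
  have hcy : c * (t * x ^ (-α)) = B := by
    rw [hc, hBdef, Real.div_rpow hx.le hb.le, Real.rpow_neg hx.le, Real.rpow_neg hb.le]
    have := (Real.rpow_pos_of_pos hx α).ne'
    have := (Real.rpow_pos_of_pos hb α).ne'
    field_simp
  have hpow : ∀ u : ℝ, (c * Real.exp (α * u)) ^ (1 / α) = x / b * Real.exp u := by
    intro u
    rw [Real.mul_rpow hc0.le (Real.exp_pos _).le, hc, ← Real.rpow_mul (by positivity),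
      ← Real.exp_mul, mul_one_div_cancel hα0.ne', Real.rpow_one]
    congr 2
    field_simp
  set y := t * x ^ (-α) with hy
  have key : ∀ u : ℝ, (c * (Real.exp (α * u) * α)) •
      (Complex.exp (-Complex.I * ((c * Real.exp (α * u) : ℝ) : ℂ) * (y : ℂ)) *
        Complex.exp (-(b : ℂ) * (((c * Real.exp (α * u)) ^ (1 / α) : ℝ) : ℂ) *
          Complex.exp (-Complex.I * (Real.pi : ℂ) * ((1 / α : ℝ) : ℂ) / 2))) =
      (starRingEnd ℂ) (-Complex.I * (α * c : ℝ) *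
        (dualPhi α x B (u + ((π / (2 * α) : ℝ) : ℂ) * Complex.I) *
        Complex.exp (α * (u + ((π / (2 * α) : ℝ) : ℂ) * Complex.I)))) := by
    intro u
    have hαC : (α : ℂ) ≠ 0 := by exact_mod_cast hα0.ne'
    have hbC : (b : ℂ) ≠ 0 := by exact_mod_cast hb.ne'
    have e1 : Complex.exp (α * (u + ((π / (2 * α) : ℝ) : ℂ) * Complex.I)) =
        Complex.exp (α * u) * Complex.I := by
      have : (α : ℂ) * (u + ((π / (2 * α) : ℝ) : ℂ) * Complex.I) =
          α * u + (π : ℂ) / 2 * Complex.I := by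
        push_cast
        field_simp
      rw [this, Complex.exp_add, Complex.exp_pi_div_two_mul_I]
    have e2 : (starRingEnd ℂ) (Complex.exp (u + ((π / (2 * α) : ℝ) : ℂ) * Complex.I)) =
        Complex.exp u * Complex.exp (-Complex.I * (Real.pi : ℂ) * ((1 / α : ℝ) : ℂ) / 2) := by
      rw [← Complex.exp_conj, ← Complex.exp_add]
      congr 1
      simp only [map_add, map_mul, Complex.conj_ofReal, Complex.conj_I]
      push_cast
      field_simp
    have e3 : (starRingEnd ℂ) (Complex.exp (α * u)) = Complex.exp (α * u) := by
      rw [← Complex.exp_conj]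
      simp
    have e4 : (starRingEnd ℂ) (dualPhi α x B (u + ((π / (2 * α) : ℝ) : ℂ) * Complex.I)) =
        Complex.exp (-Complex.I * ((c * Real.exp (α * u) : ℝ) : ℂ) * (y : ℂ)) *
        Complex.exp (-(b : ℂ) * (((c * Real.exp (α * u)) ^ (1 / α) : ℝ) : ℂ) *
          Complex.exp (-Complex.I * (Real.pi : ℂ) * ((1 / α : ℝ) : ℂ) / 2)) := by
      rw [dualPhi, ← Complex.exp_conj, ← Complex.exp_add, map_add, map_mul, map_mul, e1, e2,
        map_mul, e3, hpow, ← hcy]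
      congr 1
      simp only [map_neg, Complex.conj_ofReal, Complex.conj_I]
      push_cast
      field_simp
      ring
    rw [map_mul, map_mul, map_mul, e4, e1, map_mul, e3, Complex.real_smul]
    simp only [map_neg, Complex.conj_ofReal, Complex.conj_I]
    push_cast
    generalize Complex.exp (-Complex.I * ((c : ℂ) * Complex.exp (α * u)) * (y : ℂ)) = E1
    generalize Complex.exp (-(b : ℂ) * _ * _) = E2
    generalize Complex.exp ((α : ℂ) * u) = E3
    linear_combination (α * c * E1 * E2 * E3) * Complex.I_mul_I
  have hint : Integrable (fun u : ℝ => (starRingEnd ℂ) (-Complex.I * (α * c : ℝ) *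
        (dualPhi α x B (u + ((π / (2 * α) : ℝ) : ℂ) * Complex.I) *
        Complex.exp (α * (u + ((π / (2 * α) : ℝ) : ℂ) * Complex.I))))) :=
    Complex.conjCLE.toContinuousLinearMap.integrable_comp (hI.const_mul _)
  rw [zol_half, dual_cov hα0 hc0]
  · simp only [key]
    rw [integral_conj, Complex.conj_re, integral_const_mul]
  · rw [dual_cov_int hα0 hc0]
    simp only [key]
    exact hint

lemma zol_dual {α x b t : ℝ} (hα1 : 1 < α) (hα2 : α ≤ 2) (hx : 0 < x) (hb : 0 < b)
    (ht : 0 < t) :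
    zolDensity α (2 - α) (b ^ (-α) * t) x =
      t * x ^ (-1 - α) * zolDensity (1 / α) (1 / α) b (t * x ^ (-α)) := by
  have hle : π / (2 * α) ≤ π / 2 := by
    apply div_le_div_of_nonneg_left Real.pi_pos.le (by norm_num) (by linarith)
  have hB : 0 < b ^ (-α) * t := by positivity
  rw [zol_left hα1 hα2 hx hB, zol_right hα1 hα2 hx hb ht, ← dual_shift hα1 hα2 hx hB]
  have h := dual_ibp hα1 hα2 hx hB (θ := π / (2 * α)) ⟨le_rfl, hle⟩
  generalize (∫ u : ℝ, dualPhi α x (b ^ (-α) * t) (u + ((π / (2 * α) : ℝ) : ℂ) * Complex.I) *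
        Complex.exp (α * (u + ((π / (2 * α) : ℝ) : ℂ) * Complex.I))) = J at *
  generalize (∫ u : ℝ, dualPhi α x (b ^ (-α) * t) (u + ((π / (2 * α) : ℝ) : ℂ) * Complex.I) *
        Complex.exp (u + ((π / (2 * α) : ℝ) : ℂ) * Complex.I)) = K at *
  have him := congrArg Complex.im h
  have h1 : α * (b ^ (-α) * t) * J.im = x * K.im := by
    rw [← Complex.ofReal_mul, Complex.im_ofReal_mul] at him
    simpa using him
  have hJ : (-Complex.I * (α * (x / b) ^ α : ℝ) * J).re = α * (x / b) ^ α * J.im := by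
    rw [mul_assoc, neg_mul, Complex.neg_re, Complex.I_mul_re, Complex.im_ofReal_mul, neg_neg]
  have hK : (-Complex.I * K).re = K.im := by simp
  rw [hJ, hK, Real.div_rpow hx.le hb.le, sub_eq_add_neg, Real.rpow_add hx, Real.rpow_neg_one,
    Real.rpow_neg hx.le]
  rw [Real.rpow_neg hb.le] at h1
  have hxp := (Real.rpow_pos_of_pos hx α).ne'
  have hbp := (Real.rpow_pos_of_pos hb α).ne'
  field_simp at h1 ⊢
  linear_combination -h1

/-- Space-time duality for densities. -/
theorem space_time_duality_densities (α b : ℝ) (hα1 : 1 < α) (hα2 : α ≤ 2) (hb : 0 < b)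
    (γ : ℝ) (hγ : γ = 1 / α)
    (g : ℝ → ℝ) (hg : ∀ x, g x = zolDensity γ γ b x)
    (h : ℝ → ℝ → ℝ)
    (hh : ∀ x t, h x t = (t / γ) * x ^ (-1 - 1 / γ) * g (t * x ^ (-(1 / γ)))) :
    ∀ x t : ℝ, 0 < x → 0 < t →
      zolDensity α (2 - α) (b ^ (-α) * t) x = γ * h x t ∧
      zolDensity α (2 - α) (b ^ (-α) * t) x = t * x ^ (-1 - α) * g (t * x ^ (-α)) := by
  intro x t hx ht
  have hα0 : 0 < α := by linarith
  have main := zol_dual hα1 hα2 hx hb ht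
  subst hγ
  rw [hh, hg, hg, one_div_one_div, main]
  refine ⟨?_, rfl⟩
  field_simp
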